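/- For every A ∈ GL(n,k), the collection of linear relations (χ_ij(A))_{1 ≤ i ≤ p, 1 ≤ j ≤ q} is a bi-hinge. (Proposition 1(b).) -/

import Mathlib

namespace Neretin

open scoped BigOperators

variable {k : Type*} [Field k]

/-- Offset of the `i`-th block of the partition `α`. -/
def off {p : ℕ} (α : Fin p → ℕ) (i : Fin p) : ℕ := ∑ i' ∈ Finset.Iio i, α i'

theorem coord_lt {p n : ℕ} {α : Fin p → ℕ} (hα : ∑ i, α i = n) (i : Fin p)
    (t : Fin (α i)) : off α i + (t : ℕ) < n := by
  have h1 : off α i + α i ≤ n := by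
    rw [← hα]
    have h2 : insert i (Finset.Iio i) = Finset.Iic i := Finset.Iio_insert i
    have h3 : off α i + α i = ∑ i' ∈ Finset.Iic i, α i' := by
      rw [← h2, Finset.sum_insert (by simp)]
      unfold off
      omega
    rw [h3]
    exact Finset.sum_le_sum_of_subset (Finset.subset_univ _)
  have h4 := t.isLt
  omega

/-- The coordinate of `k^n` corresponding to the `t`-th coordinate of the `i`-th block. -/
def coord {p n : ℕ} {α : Fin p → ℕ} (hα : ∑ i, α i = n) (i : Fin p) (t : Fin (α i)) : Fin n :=
  ⟨off α i + (t : ℕ), coord_lt hα i t⟩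

/-- Subspace of vectors vanishing at all coordinates satisfying `P`. -/
def vanishOn {ι : Type*} (P : ι → Prop) : Submodule k (ι → k) :=
  ⨅ r ∈ {r : ι | P r}, LinearMap.ker (LinearMap.proj (R := k) (φ := fun _ : ι => k) r)

/-- The linear relation `χ_ij(A) : V_i ⇉ W_j`. -/
def chi {p q n : ℕ} (α : Fin p → ℕ) (β : Fin q → ℕ) (hα : ∑ i, α i = n) (hβ : ∑ j, β j = n)
    (A : Matrix (Fin n) (Fin n) k) (i : Fin p) (j : Fin q) :
    Submodule k ((Fin (α i) → k) × (Fin (β j) → k)) :=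
  Submodule.map
    ((LinearMap.funLeft k k (coord hα i)).prod
      ((LinearMap.funLeft k k (coord hβ j)).comp (Matrix.mulVecLin A)))
    (vanishOn (fun r : Fin n => off α i + α i ≤ (r : ℕ)) ⊓
      Submodule.comap (Matrix.mulVecLin A) (vanishOn fun r : Fin n => (r : ℕ) < off β j))

section Rel

variable {X Y : Type*} [AddCommGroup X] [Module k X] [AddCommGroup Y] [Module k Y]

/-- Kernel of a linear relation. -/
def rker (L : Submodule k (X × Y)) : Submodule k X := Submodule.comap (LinearMap.inl k X Y) L

/-- Domain of a linear relation. -/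
def rdom (L : Submodule k (X × Y)) : Submodule k X := Submodule.map (LinearMap.fst k X Y) L

/-- Image of a linear relation. -/
def rim (L : Submodule k (X × Y)) : Submodule k Y := Submodule.map (LinearMap.snd k X Y) L

/-- Indefiniteness of a linear relation. -/
def rindef (L : Submodule k (X × Y)) : Submodule k Y := Submodule.comap (LinearMap.inr k X Y) L

end Rel

/-- `blockLT α a b`: coordinate `a` lies in a strictly earlier block than `b`. -/
def blockLT {p : ℕ} (α : Fin p → ℕ) (a b : ℕ) : Prop :=
  ∃ i : Fin p, off α i ≤ b ∧ a < off α i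

/-- `sameBlock α a b` : coordinates `a`, `b` lie in the same block. -/
def sameBlock {p : ℕ} (α : Fin p → ℕ) (a b : ℕ) : Prop :=
  ∀ i : Fin p, off α i ≤ a ↔ off α i ≤ b

/-- Block upper triangular matrices (the group `P_+`). -/
def IsPPlus {n p : ℕ} (α : Fin p → ℕ) (g : Matrix (Fin n) (Fin n) k) : Prop :=
  ∀ r s : Fin n, blockLT α (s : ℕ) (r : ℕ) → g r s = 0

/-- Block lower triangular matrices (the group `P_-`). -/
def IsPMinus {n p : ℕ} (α : Fin p → ℕ) (g : Matrix (Fin n) (Fin n) k) : Prop :=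
  ∀ r s : Fin n, blockLT α (r : ℕ) (s : ℕ) → g r s = 0

/-- Block strictly upper triangular matrices (the group `T_+`). -/
def IsTPlus {n p : ℕ} (α : Fin p → ℕ) (g : Matrix (Fin n) (Fin n) k) : Prop :=
  IsPPlus α g ∧ ∀ r s : Fin n, sameBlock α (r : ℕ) (s : ℕ) → g r s = if r = s then 1 else 0

/-- Block strictly lower triangular matrices (the group `T_-`). -/
def IsTMinus {n p : ℕ} (α : Fin p → ℕ) (g : Matrix (Fin n) (Fin n) k) : Prop :=
  IsPMinus α g ∧ ∀ r s : Fin n, sameBlock α (r : ℕ) (s : ℕ) → g r s = if r = s then 1 else 0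

/-- Bi-hinges. -/
def IsBiHinge {p q : ℕ} (α : Fin p → ℕ) (β : Fin q → ℕ)
    (ξ : (i : Fin p) → (j : Fin q) → Submodule k ((Fin (α i) → k) × (Fin (β j) → k))) : Prop :=
  (∀ (i : Fin p) (j j' : Fin q), (j' : ℕ) = (j : ℕ) + 1 → rker (ξ i j) = rdom (ξ i j')) ∧
  (∀ (i i' : Fin p) (j : Fin q), (i' : ℕ) = (i : ℕ) + 1 → rim (ξ i j) = rindef (ξ i' j)) ∧
  (∀ (i : Fin p) (j : Fin q), (i : ℕ) = 0 → rindef (ξ i j) = ⊥) ∧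
  (∀ (i : Fin p) (j : Fin q), (i : ℕ) + 1 = p → rim (ξ i j) = ⊤) ∧
  (∀ (i : Fin p) (j : Fin q), (j : ℕ) + 1 = q → rker (ξ i j) = ⊥) ∧
  (∀ (i : Fin p) (j : Fin q), (j : ℕ) = 0 → rdom (ξ i j) = ⊤)

/-- 0-1 matrices with exactly one unit in each row and each column. -/
def IsPermMatrix {n : ℕ} (M : Matrix (Fin n) (Fin n) k) : Prop :=
  ∃ σ : Equiv.Perm (Fin n), ∀ r s, M r s = if r = σ s then 1 else 0

/-- Offset of the sub-block `V_i^j` inside `V_i`. -/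
def offA {p q : ℕ} (a : Fin p → Fin q → ℕ) (i : Fin p) (j : Fin q) : ℕ :=
  ∑ j' ∈ Finset.Iio j, a i j'

/-- Offset of the sub-block `W_j^i` inside `W_j`. -/
def offB {p q : ℕ} (a : Fin p → Fin q → ℕ) (i : Fin p) (j : Fin q) : ℕ :=
  ∑ i' ∈ Finset.Iio i, a i' j

open Classical in
/-- The standard 0-1 matrix determined by the dimension data `a`. -/
noncomputable def stdMatrix {p q : ℕ} (n : ℕ) (α : Fin p → ℕ) (β : Fin q → ℕ)
    (a : Fin p → Fin q → ℕ) : Matrix (Fin n) (Fin n) k :=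
  Matrix.of fun r s : Fin n =>
    if ∃ (i : Fin p) (j : Fin q) (t : ℕ), t < a i j ∧
        (s : ℕ) = off α i + offA a i j + t ∧ (r : ℕ) = off β j + offB a i j + t
      then (1 : k) else 0

/-- The standard bi-hinge determined by the dimension data `a`. -/
def stdHinge {p q : ℕ} (α : Fin p → ℕ) (β : Fin q → ℕ) (a : Fin p → Fin q → ℕ)
    (i : Fin p) (j : Fin q) : Submodule k ((Fin (α i) → k) × (Fin (β j) → k)) where
  carrier := {z | (∀ u : Fin (α i), (u : ℕ) < offA a i j → z.1 u = 0) ∧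
    (∀ v : Fin (β j), offB a i j + a i j ≤ (v : ℕ) → z.2 v = 0) ∧
    ∀ (u : Fin (α i)) (v : Fin (β j)) (t : ℕ), t < a i j →
      (u : ℕ) = offA a i j + t → (v : ℕ) = offB a i j + t → z.1 u = z.2 v}
  add_mem' := by
    rintro x y ⟨hx1, hx2, hx3⟩ ⟨hy1, hy2, hy3⟩
    refine ⟨fun u hu => ?_, fun v hv => ?_, fun u v t ht hu hv => ?_⟩
    · show x.1 u + y.1 u = 0
      rw [hx1 u hu, hy1 u hu, add_zero]
    · show x.2 v + y.2 v = 0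
      rw [hx2 v hv, hy2 v hv, add_zero]
    · show x.1 u + y.1 u = x.2 v + y.2 v
      rw [hx3 u v t ht hu hv, hy3 u v t ht hu hv]
  zero_mem' := ⟨fun _ _ => rfl, fun _ _ => rfl, fun _ _ _ _ _ _ => rfl⟩
  smul_mem' := by
    rintro c x ⟨hx1, hx2, hx3⟩
    refine ⟨fun u hu => ?_, fun v hv => ?_, fun u v t ht hu hv => ?_⟩
    · show c * x.1 u = 0
      rw [hx1 u hu, mul_zero]
    · show c * x.2 v = 0
      rw [hx2 v hv, mul_zero]
    · show c * x.1 u = c * x.2 v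
      rw [hx3 u v t ht hu hv]

theorem off_eq_zero {p : ℕ} (α : Fin p → ℕ) {i : Fin p} (hi : (i : ℕ) = 0) : off α i = 0 := by
  refine Finset.sum_eq_zero fun x hx => ?_
  have : x < i := Finset.mem_Iio.mp hx
  omega

theorem off_add_eq_sum_Iic {p : ℕ} (α : Fin p → ℕ) (i : Fin p) :
    off α i + α i = ∑ i' ∈ Finset.Iic i, α i' := by
  rw [← Finset.Iio_insert i, Finset.sum_insert (by simp), off, add_comm]

theorem off_succ {p : ℕ} (α : Fin p → ℕ) {i i' : Fin p} (h : (i' : ℕ) = (i : ℕ) + 1) :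
    off α i' = off α i + α i := by
  rw [off_add_eq_sum_Iic]
  refine Finset.sum_congr ?_ fun _ _ => rfl
  ext x
  simp only [Finset.mem_Iio, Finset.mem_Iic, Fin.lt_def, Fin.le_def]
  omega

theorem off_add_last {p n : ℕ} {α : Fin p → ℕ} (hα : ∑ i, α i = n) {i : Fin p}
    (h : (i : ℕ) + 1 = p) : off α i + α i = n := by
  rw [off_add_eq_sum_Iic, ← hα]
  refine Finset.sum_congr ?_ fun _ _ => rfl
  ext x
  have := x.isLt
  simp only [Finset.mem_univ, Finset.mem_Iic, Fin.le_def, iff_true]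
  omega

theorem coord_injective {p n : ℕ} {α : Fin p → ℕ} (hα : ∑ i, α i = n) (i : Fin p) :
    Function.Injective (coord hα i) := by
  intro s t h
  have := congrArg Fin.val h
  simp only [coord] at this
  exact Fin.ext (by omega)

theorem exists_coord_eq {p n : ℕ} {α : Fin p → ℕ} (hα : ∑ i, α i = n) {i : Fin p} {r : Fin n}
    (h₁ : off α i ≤ r) (h₂ : (r : ℕ) < off α i + α i) : ∃ t, coord hα i t = r :=
  ⟨⟨r - off α i, by omega⟩, Fin.ext (by simp only [coord]; omega)⟩

theorem mem_vanishOn {ι : Type*} {P : ι → Prop} {v : ι → k} :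
    v ∈ vanishOn P ↔ ∀ r, P r → v r = 0 := by
  simp [vanishOn, Submodule.mem_iInf]

/-- Extension by zero of a vector supported on the `i`-th block. -/
theorem exists_extend_block {p n : ℕ} {α : Fin p → ℕ} (hα : ∑ i, α i = n) (i : Fin p)
    (x : Fin (α i) → k) : ∃ v : Fin n → k, (∀ t, v (coord hα i t) = x t) ∧
      (∀ r : Fin n, (r : ℕ) < off α i → v r = 0) ∧
      ∀ r : Fin n, off α i + α i ≤ r → v r = 0 := by
  refine ⟨Function.extend (coord hα i) x 0,
    fun t => (coord_injective hα i).extend_apply _ _ _, fun r hr => ?_, fun r hr => ?_⟩ <;>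
  · refine Function.extend_apply' _ _ _ ?_
    rintro ⟨t, rfl⟩
    have := t.isLt
    simp only [coord] at hr
    omega

/-- Vanishing below the end of a block splits into vanishing below it and vanishing on it. -/
theorem forall_lt_block_end {p n : ℕ} {α : Fin p → ℕ} (hα : ∑ i, α i = n) {i : Fin p}
    {v : Fin n → k} : (∀ r : Fin n, (r : ℕ) < off α i + α i → v r = 0) ↔
      (∀ r : Fin n, (r : ℕ) < off α i → v r = 0) ∧ ∀ t, v (coord hα i t) = 0 := by
  refine ⟨fun h => ⟨fun r hr => h r (by omega), fun t => h _ (by simp [coord])⟩,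
    fun ⟨h₁, h₂⟩ r hr => ?_⟩
  by_cases hr' : (r : ℕ) < off α i
  · exact h₁ r hr'
  · obtain ⟨t, rfl⟩ := exists_coord_eq hα (not_lt.mp hr') hr
    exact h₂ t

/-- Vanishing from the start of a block splits into vanishing above it and vanishing on it. -/
theorem forall_block_start_le {p n : ℕ} {α : Fin p → ℕ} (hα : ∑ i, α i = n) {i : Fin p}
    {v : Fin n → k} : (∀ r : Fin n, off α i ≤ r → v r = 0) ↔
      (∀ r : Fin n, off α i + α i ≤ r → v r = 0) ∧ ∀ t, v (coord hα i t) = 0 := by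
  refine ⟨fun h => ⟨fun r hr => h r (by omega), fun t => h _ (by simp [coord])⟩,
    fun ⟨h₁, h₂⟩ r hr => ?_⟩
  by_cases hr' : off α i + α i ≤ (r : ℕ)
  · exact h₁ r hr'
  · obtain ⟨t, rfl⟩ := exists_coord_eq hα hr (not_le.mp hr')
    exact h₂ t

section Chi

variable {p q n : ℕ} {α : Fin p → ℕ} {β : Fin q → ℕ} (hα : ∑ i, α i = n) (hβ : ∑ j, β j = n)
  (A : Matrix (Fin n) (Fin n) k) {i : Fin p} {j : Fin q}

theorem mem_chi {x : Fin (α i) → k} {y : Fin (β j) → k} :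
    (x, y) ∈ chi α β hα hβ A i j ↔ ∃ v : Fin n → k,
      (∀ r : Fin n, off α i + α i ≤ r → v r = 0) ∧
      (∀ r : Fin n, (r : ℕ) < off β j → A.mulVec v r = 0) ∧
      (∀ t, v (coord hα i t) = x t) ∧ ∀ t, A.mulVec v (coord hβ j t) = y t := by
  simp [chi, mem_vanishOn, funext_iff, LinearMap.funLeft_apply, and_assoc]

theorem mem_rdom_chi {x : Fin (α i) → k} :
    x ∈ rdom (chi α β hα hβ A i j) ↔ ∃ v : Fin n → k,
      (∀ r : Fin n, off α i + α i ≤ r → v r = 0) ∧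
      (∀ r : Fin n, (r : ℕ) < off β j → A.mulVec v r = 0) ∧ ∀ t, v (coord hα i t) = x t := by
  simp only [rdom, Submodule.mem_map, Prod.exists, mem_chi, LinearMap.fst_apply]
  constructor
  · rintro ⟨_, _, ⟨v, h₁, h₂, h₃, -⟩, rfl⟩
    exact ⟨v, h₁, h₂, h₃⟩
  · rintro ⟨v, h₁, h₂, h₃⟩
    exact ⟨x, _, ⟨v, h₁, h₂, h₃, fun _ => rfl⟩, rfl⟩

theorem mem_rim_chi {y : Fin (β j) → k} :
    y ∈ rim (chi α β hα hβ A i j) ↔ ∃ v : Fin n → k,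
      (∀ r : Fin n, off α i + α i ≤ r → v r = 0) ∧
      (∀ r : Fin n, (r : ℕ) < off β j → A.mulVec v r = 0) ∧
      ∀ t, A.mulVec v (coord hβ j t) = y t := by
  simp only [rim, Submodule.mem_map, Prod.exists, mem_chi, LinearMap.snd_apply]
  constructor
  · rintro ⟨_, _, ⟨v, h₁, h₂, -, h₃⟩, rfl⟩
    exact ⟨v, h₁, h₂, h₃⟩
  · rintro ⟨v, h₁, h₂, h₃⟩
    exact ⟨_, y, ⟨v, h₁, h₂, fun _ => rfl, h₃⟩, rfl⟩

theorem mem_rker_chi {x : Fin (α i) → k} :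
    x ∈ rker (chi α β hα hβ A i j) ↔ ∃ v : Fin n → k,
      (∀ r : Fin n, off α i + α i ≤ r → v r = 0) ∧
      (∀ r : Fin n, (r : ℕ) < off β j + β j → A.mulVec v r = 0) ∧
      ∀ t, v (coord hα i t) = x t := by
  simp only [rker, Submodule.mem_comap, LinearMap.inl_apply, mem_chi, forall_lt_block_end hβ,
    Pi.zero_apply]
  exact exists_congr fun v => by tauto

theorem mem_rindef_chi {y : Fin (β j) → k} :
    y ∈ rindef (chi α β hα hβ A i j) ↔ ∃ v : Fin n → k,
      (∀ r : Fin n, off α i ≤ r → v r = 0) ∧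
      (∀ r : Fin n, (r : ℕ) < off β j → A.mulVec v r = 0) ∧
      ∀ t, A.mulVec v (coord hβ j t) = y t := by
  simp only [rindef, Submodule.mem_comap, LinearMap.inr_apply, mem_chi, forall_block_start_le hα,
    Pi.zero_apply]
  exact exists_congr fun v => by tauto

end Chi

theorem statement4 (p q n : ℕ) (hp : 0 < p) (hq : 0 < q)
    (α : Fin p → ℕ) (β : Fin q → ℕ)
    (hαpos : ∀ i, 0 < α i) (hβpos : ∀ j, 0 < β j)
    (hα : ∑ i, α i = n) (hβ : ∑ j, β j = n)
    (A : GL (Fin n) k) :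
    IsBiHinge α β (chi α β hα hβ A.val) := by
  refine ⟨fun i j j' h => ?_, fun i i' j h => ?_, fun i j h => ?_, fun i j h => ?_,
    fun i j h => ?_, fun i j h => ?_⟩
  · ext x
    rw [mem_rker_chi, mem_rdom_chi, off_succ β h]
  · ext y
    rw [mem_rim_chi, mem_rindef_chi, off_succ α h]
  · refine (Submodule.eq_bot_iff _).mpr fun y hy => ?_
    obtain ⟨v, hv, -, hy⟩ := (mem_rindef_chi hα hβ A.val).mp hy
    obtain rfl : v = 0 := funext fun r => hv r (by simp [off_eq_zero α h])
    ext t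
    simp [← hy t]
  · refine Submodule.eq_top_iff'.mpr fun y => (mem_rim_chi hα hβ A.val).mpr ?_
    obtain ⟨w, hw, hlow, -⟩ := exists_extend_block hβ j y
    have hA : A.val.mulVec ((A⁻¹).val.mulVec w) = w := by
      rw [Matrix.mulVec_mulVec, Units.mul_inv, Matrix.one_mulVec]
    refine ⟨(A⁻¹).val.mulVec w, fun r hr => ?_, hA.symm ▸ hlow, hA.symm ▸ hw⟩
    have := r.isLt
    have := off_add_last hα h
    omega
  · refine (Submodule.eq_bot_iff _).mpr fun x hx => ?_
    obtain ⟨v, -, hv, hx⟩ := (mem_rker_chi hα hβ A.val).mp hx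
    have hAv : A.val.mulVec v = 0 := funext fun r => hv r (by rw [off_add_last hβ h]; exact r.isLt)
    obtain rfl : v = 0 := by
      rw [← Matrix.one_mulVec v, ← Units.inv_mul A, ← Matrix.mulVec_mulVec, hAv,
        Matrix.mulVec_zero]
    ext t
    simp [← hx t]
  · refine Submodule.eq_top_iff'.mpr fun x => (mem_rdom_chi hα hβ A.val).mpr ?_
    obtain ⟨v, hv, -, hhigh⟩ := exists_extend_block hα i x
    exact ⟨v, hhigh, fun r hr => by simp [off_eq_zero β h] at hr, hv⟩

end Neretin
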